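/- arXiv:1310.7088 — 2 statements merged into one kernel-verified Lean document; each statement's English description precedes it below -/
import Mathlib

section
/- Let p ≥ 3 be a prime and let G be an absolutely irreducible subgroup of GL₂(𝔽_p) such that G ∩ SL₂(𝔽_p) is absolutely reducible and det(G) = 𝔽_p*. Then G ∩ GL₂⁺(𝔽_p) is contained in a Cartan subgroup, where GL₂⁺(𝔽_p) denotes the subgroup of matrices whose determinant is a square in 𝔽_p*. -/
open Matrix

/-- A subgroup of `GL₂(𝔽_p)` is absolutely irreducible if its natural two-dimensional
representation over the algebraic closure of `𝔽_p` is irreducible, i.e. the only invariant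
subspaces are `⊥` and `⊤`. -/
def IsAbsolutelyIrreducible (p : ℕ) [Fact p.Prime] (G : Subgroup (GL (Fin 2) (ZMod p))) : Prop :=
  ∀ W : Submodule (AlgebraicClosure (ZMod p)) (Fin 2 → AlgebraicClosure (ZMod p)),
    (∀ g ∈ G, ∀ w ∈ W,
      (((g : GL (Fin 2) (ZMod p)) : Matrix (Fin 2) (Fin 2) (ZMod p)).map
        (algebraMap (ZMod p) (AlgebraicClosure (ZMod p)))).mulVec w ∈ W) →
    W = ⊥ ∨ W = ⊤

/-- `SL₂(𝔽_p)` as a subgroup of `GL₂(𝔽_p)`: the kernel of the determinant. -/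
def SL2 (p : ℕ) : Subgroup (GL (Fin 2) (ZMod p)) :=
  (Matrix.GeneralLinearGroup.det : GL (Fin 2) (ZMod p) →* (ZMod p)ˣ).ker

/-- A split Cartan subgroup of `GL₂(𝔽_p)`: a conjugate of the diagonal torus. -/
def IsSplitCartan (p : ℕ) (C : Subgroup (GL (Fin 2) (ZMod p))) : Prop :=
  ∃ g : GL (Fin 2) (ZMod p), ∀ u : GL (Fin 2) (ZMod p), u ∈ C ↔
    ∃ a b : (ZMod p)ˣ,
      ((g * u * g⁻¹ : GL (Fin 2) (ZMod p)) : Matrix (Fin 2) (Fin 2) (ZMod p)) =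
        Matrix.diagonal ![(a : ZMod p), (b : ZMod p)]

/-- A non-split Cartan subgroup of `GL₂(𝔽_p)`: the image of `𝔽_{p²}ˣ` under an embedding of
rings `𝔽_{p²} → M₂(𝔽_p)`. -/
def IsNonsplitCartan (p : ℕ) [Fact p.Prime] (C : Subgroup (GL (Fin 2) (ZMod p))) : Prop :=
  ∃ f : GaloisField p 2 →+* Matrix (Fin 2) (Fin 2) (ZMod p),
    ∀ u : GL (Fin 2) (ZMod p), u ∈ C ↔
      ∃ x : GaloisField p 2, x ≠ 0 ∧ ((u : Matrix (Fin 2) (Fin 2) (ZMod p)) = f x)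

/-- A Cartan subgroup of `GL₂(𝔽_p)` is either a split or a non-split Cartan subgroup. -/
def IsCartan (p : ℕ) [Fact p.Prime] (C : Subgroup (GL (Fin 2) (ZMod p))) : Prop :=
  IsSplitCartan p C ∨ IsNonsplitCartan p C


/-- The subgroup `GL₂⁺(𝔽_p)` of matrices whose determinant is a square in `𝔽_p*`. -/
def GL2plus (p : ℕ) : Subgroup (GL (Fin 2) (ZMod p)) :=
  Subgroup.comap (Matrix.GeneralLinearGroup.det : GL (Fin 2) (ZMod p) →* (ZMod p)ˣ)
    (powMonoidHom 2 : (ZMod p)ˣ →* (ZMod p)ˣ).range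

namespace Matrix

variable {F : Type*} [Field F]

/-- A diagonalizable nonscalar `2 × 2` matrix has a characteristic polynomial with nonzero
discriminant. -/
theorem discr_ne_zero_of_eq_conj_diagonal {A P : Matrix (Fin 2) (Fin 2) F} (hP : P.det ≠ 0)
    {a b : F} (hA : A = P * diagonal ![a, b] * P⁻¹) (hns : ∀ c : F, A ≠ scalar (Fin 2) c) :
    A.trace ^ 2 - 4 * A.det ≠ 0 := by
  have hPu : IsUnit P.det := isUnit_iff_ne_zero.mpr hP
  have htr : A.trace = a + b := by
    rw [hA, trace_mul_cycle, nonsing_inv_mul _ hPu, one_mul]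
    simp
  have hd : A.det = a * b := by
    rw [hA, det_mul, det_mul, mul_right_comm, ← det_mul, mul_nonsing_inv _ hPu]
    simp
  have hab : a ≠ b := by
    rintro rfl
    apply hns a
    have h : diagonal ![a, a] = scalar (Fin 2) a := by
      ext i j
      fin_cases i <;> fin_cases j <;> simp
    rw [hA, h, ← (scalar_commute a (fun _ => mul_comm _ _) P).eq, mul_assoc,
      mul_nonsing_inv _ hPu, mul_one]
  rw [htr, hd, show (a + b) ^ 2 - 4 * (a * b) = (a - b) ^ 2 by ring]
  exact pow_ne_zero 2 (sub_ne_zero.mpr hab)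

/-- A matrix commuting with a nonscalar `2 × 2` matrix `A` is a linear combination of `1`
and `A`. -/
theorem exists_eq_smul_one_add_smul_of_commute {A B : Matrix (Fin 2) (Fin 2) F} (h : Commute A B)
    (hns : ∀ c : F, A ≠ scalar (Fin 2) c) : ∃ x y : F, B = x • 1 + y • A := by
  have h00 := congr_fun₂ h.eq 0 0
  have h01 := congr_fun₂ h.eq 0 1
  have h10 := congr_fun₂ h.eq 1 0
  simp only [mul_apply, Fin.sum_univ_two] at h00 h01 h10
  suffices ∃ x y : F, B 0 0 = x + y * A 0 0 ∧ B 0 1 = y * A 0 1 ∧ B 1 0 = y * A 1 0 ∧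
      B 1 1 = x + y * A 1 1 by
    obtain ⟨x, y, e00, e01, e10, e11⟩ := this
    refine ⟨x, y, ?_⟩
    ext i j
    fin_cases i <;> fin_cases j <;> simp [*]
  by_cases hb : A 0 1 = 0
  · by_cases hc : A 1 0 = 0
    · have hd : A 0 0 - A 1 1 ≠ 0 := by
        intro hd
        apply hns (A 0 0)
        ext i j
        fin_cases i <;> fin_cases j <;> simp [hb, hc, sub_eq_zero.mp hd]
      have e01 : B 0 1 = 0 := mul_left_cancel₀ hd (by
        linear_combination h01 + (B 0 0 - B 1 1) * hb)
      have e10 : B 1 0 = 0 := mul_left_cancel₀ hd (by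
        linear_combination -h10 + (B 0 0 - B 1 1) * hc)
      refine ⟨B 0 0 - (B 0 0 - B 1 1) / (A 0 0 - A 1 1) * A 0 0,
        (B 0 0 - B 1 1) / (A 0 0 - A 1 1), by ring, by simp [e01, hb], by simp [e10, hc], ?_⟩
      field_simp
      ring
    · refine ⟨B 0 0 - B 1 0 / A 1 0 * A 0 0, B 1 0 / A 1 0, by ring, ?_, ?_, ?_⟩ <;> field_simp
      · linear_combination -h00
      · linear_combination -h10
  · refine ⟨B 0 0 - B 0 1 / A 0 1 * A 0 0, B 0 1 / A 0 1, by ring, ?_, ?_, ?_⟩ <;> field_simp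
    · linear_combination h00
    · linear_combination h01

/-- If conjugating `A` yields a matrix commuting with `A`, conjugating twice gives back `A`. -/
theorem commute_mul_self_of_commute_conj (h2 : (2 : F) ≠ 0) {A K : Matrix (Fin 2) (Fin 2) F}
    (hK : K.det ≠ 0) (hns : ∀ c : F, A ≠ scalar (Fin 2) c) (hdisc : A.trace ^ 2 - 4 * A.det ≠ 0)
    (hcomm : Commute A (K * A * K⁻¹)) : Commute (K * K) A := by
  have hKu : IsUnit K.det := isUnit_iff_ne_zero.mpr hK
  obtain ⟨x, y, hxy⟩ := exists_eq_smul_one_add_smul_of_commute hcomm hns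
  have htr : (K * A * K⁻¹).trace = A.trace := by
    rw [trace_mul_cycle, nonsing_inv_mul _ hKu, one_mul]
  have hd : (K * A * K⁻¹).det = A.det := det_conj ((isUnit_iff_isUnit_det K).mpr hKu) A
  have hKA : K * A = x • K + y • (A * K) := by
    have := congr_arg (· * K) hxy
    simpa [mul_assoc, nonsing_inv_mul _ hKu, add_mul] using this
  rw [hxy] at htr hd
  simp only [trace_fin_two, det_fin_two, add_apply, smul_apply, one_apply_eq, smul_eq_mul,
    one_apply_ne zero_ne_one, one_apply_ne one_ne_zero] at htr hd hdisc
  have hx : 2 * x = (1 - y) * (A 0 0 + A 1 1) := by linear_combination htr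
  have hy : (1 - y) * (1 + y) = 0 := by
    apply mul_right_cancel₀ hdisc
    linear_combination 4 * hd - (2 * x + (1 - y) * (A 0 0 + A 1 1) + 2 * y * (A 0 0 + A 1 1)) * hx
  have hx' : x + y * x = 0 := by
    apply mul_left_cancel₀ h2
    linear_combination (1 + y) * hx + (A 0 0 + A 1 1) * hy
  have hy' : y * y = 1 := by linear_combination -hy
  calc K * K * A = K * (K * A) := mul_assoc _ _ _
    _ = x • (K * K) + y • ((K * A) * K) := by
      rw [hKA, mul_add, mul_smul_comm, mul_smul_comm, ← hKA]
      simp only [mul_assoc]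
    _ = (x + y * x) • (K * K) + (y * y) • (A * (K * K)) := by
      rw [hKA, add_mul, smul_mul_assoc, smul_mul_assoc, smul_add, smul_smul, smul_smul, add_smul,
        add_assoc, mul_assoc]
    _ = A * (K * K) := by rw [hx', hy', zero_smul, one_smul, zero_add]

/-- A `2 × 2` matrix whose characteristic polynomial has distinct roots in the base field is
diagonalizable. -/
theorem exists_conj_eq_diagonal {A : Matrix (Fin 2) (Fin 2) F}
    (hdisc : A.trace ^ 2 - 4 * A.det ≠ 0) {a : F} (ha : a ^ 2 - A.trace * a + A.det = 0) :
    ∃ (g : GL (Fin 2) F) (b : F), a ≠ b ∧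
      (g : Matrix (Fin 2) (Fin 2) F) * A = diagonal ![a, b] * g := by
  have hab : a ≠ A.trace - a := by
    intro h
    apply hdisc
    linear_combination -4 * ha + (2 * a - A.trace) * h
  have key : ∀ c : F, c ^ 2 - A.trace * c + A.det = 0 → ∃ v : Fin 2 → F, v ≠ 0 ∧ v ᵥ* A = c • v := by
    intro c hc
    obtain ⟨v, hv, hv'⟩ := (exists_vecMul_eq_zero_iff (M := A - scalar (Fin 2) c)).mpr (by
      rw [← hc]
      simp [det_fin_two, trace_fin_two]
      ring)
    refine ⟨v, hv, ?_⟩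
    rw [vecMul_sub, sub_eq_zero] at hv'
    rw [hv']
    ext i
    fin_cases i <;> simp [mul_comm]
  obtain ⟨v, hv, hvA⟩ := key a ha
  obtain ⟨w, hw, hwA⟩ := key (A.trace - a) (by linear_combination ha)
  have hmul : of ![v, w] * A = diagonal ![a, A.trace - a] * of ![v, w] := by
    ext i j
    have hv' := congr_fun hvA j
    have hw' := congr_fun hwA j
    fin_cases i
    · simpa [mul_apply, vecMul, dotProduct] using hv'
    · simpa [mul_apply, vecMul, dotProduct] using hw'
  have hdet : (of ![v, w]).det ≠ 0 := by
    intro h0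
    obtain ⟨u, hu, hu'⟩ := exists_vecMul_eq_zero_iff.mpr h0
    have h1 : u 0 • v + u 1 • w = 0 := by
      rw [← hu']
      ext i
      simp [vecMul, dotProduct]
    have h2 : u 0 • (a • v) + u 1 • ((A.trace - a) • w) = 0 := by
      rw [← hvA, ← hwA, ← smul_vecMul, ← smul_vecMul, ← add_vecMul, h1, zero_vecMul]
    have h3 : (a - (A.trace - a)) • (u 0 • v) = 0 := by
      linear_combination (norm := module) h2 - (A.trace - a) • h1
    have h4 : (a - (A.trace - a)) • (u 1 • w) = 0 := by
      linear_combination (norm := module) a • h1 - h2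
    have hne := sub_ne_zero.mpr hab
    simp only [smul_eq_zero, hne, hv, hw, false_or, or_false] at h3 h4
    exact hu (by ext i; fin_cases i <;> assumption)
  exact ⟨GeneralLinearGroup.mkOfDetNeZero _ hdet, _, hab, hmul⟩

/-- A matrix commuting with a diagonal `2 × 2` matrix with distinct entries is diagonal. -/
theorem eq_diagonal_of_commute_diagonal {B : Matrix (Fin 2) (Fin 2) F} {a b : F} (hab : a ≠ b)
    (h : Commute (diagonal ![a, b]) B) : B = diagonal ![B 0 0, B 1 1] := by
  have hne := sub_ne_zero.mpr hab
  have h01 := congr_fun₂ h.eq 0 1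
  have h10 := congr_fun₂ h.eq 1 0
  simp only [diagonal_mul, mul_diagonal, cons_val_zero, cons_val_one] at h01 h10
  have e01 : B 0 1 = 0 := mul_left_cancel₀ hne (by linear_combination h01)
  have e10 : B 1 0 = 0 := mul_left_cancel₀ hne (by linear_combination -h10)
  ext i j
  fin_cases i <;> fin_cases j <;> simp [e01, e10]

end Matrix

section Cartan

variable {p : ℕ} [Fact p.Prime]

theorem isSplitCartan_centralizer {h : GL (Fin 2) (ZMod p)}
    (hdisc : h.1.trace ^ 2 - 4 * h.1.det ≠ 0) {a : ZMod p}
    (ha : a ^ 2 - h.1.trace * a + h.1.det = 0) :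
    IsSplitCartan p (Subgroup.centralizer {h}) := by
  obtain ⟨g, b, hab, hg⟩ := Matrix.exists_conj_eq_diagonal hdisc ha
  have hconj : ((g * h * g⁻¹ : GL (Fin 2) (ZMod p)) : Matrix (Fin 2) (Fin 2) (ZMod p)) =
      Matrix.diagonal ![a, b] := by
    rw [Units.val_mul, Units.val_mul, hg, mul_assoc, Units.mul_inv, mul_one]
  refine ⟨g, fun u => ?_⟩
  rw [Subgroup.mem_centralizer_singleton_iff]
  constructor
  · intro hu
    have hcomm : Commute (g * h * g⁻¹) (g * u * g⁻¹) := Commute.conj_iff g |>.mpr hu.symm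
    have hdiag := Matrix.eq_diagonal_of_commute_diagonal hab
      (hconj ▸ hcomm.map (Units.coeHom _) : Commute _
        ((g * u * g⁻¹ : GL (Fin 2) (ZMod p)) : Matrix (Fin 2) (Fin 2) (ZMod p)))
    have hne := ((Matrix.isUnit_iff_isUnit_det _).mp (g * u * g⁻¹).isUnit).ne_zero
    rw [hdiag, Matrix.det_diagonal, Fin.prod_univ_two] at hne
    exact ⟨Units.mk0 _ (left_ne_zero_of_mul hne), Units.mk0 _ (right_ne_zero_of_mul hne), hdiag⟩
  · rintro ⟨x, y, hxy⟩
    have hcomm : Commute (g * u * g⁻¹) (g * h * g⁻¹) := by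
      refine Units.ext ?_
      rw [Units.val_mul (g * u * g⁻¹), Units.val_mul (g * h * g⁻¹), hxy, hconj]
      exact Matrix.commute_diagonal _ _
    exact (Commute.conj_iff g).mp hcomm

theorem isNonsplitCartan_centralizer {h : GL (Fin 2) (ZMod p)}
    (hroot : ∀ a : ZMod p, a ^ 2 - h.1.trace * a + h.1.det ≠ 0) :
    IsNonsplitCartan p (Subgroup.centralizer {h}) := by
  have hns : ∀ c : ZMod p, h.1 ≠ Matrix.scalar (Fin 2) c := by
    intro c hc
    apply hroot c
    rw [hc]
    simp
    ring
  set q : Polynomial (ZMod p) := h.1.charpoly with hq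
  have hdeg : q.natDegree = 2 := by simp [hq]
  have hmonic : q.Monic := h.1.charpoly_monic
  have hirr : Irreducible q := by
    rw [hmonic.irreducible_iff_roots_eq_zero_of_degree_le_three hdeg.ge (by omega)]
    refine Multiset.eq_zero_of_forall_notMem fun a ha => hroot a ?_
    have := (Polynomial.mem_roots'.mp ha).2
    rw [Polynomial.IsRoot, hq, Matrix.charpoly_fin_two] at this
    simpa using this
  have : Fact (Irreducible q) := ⟨hirr⟩
  have hfin : Module.finrank (ZMod p) (AdjoinRoot q) = 2 := by
    rw [(AdjoinRoot.powerBasis hirr.ne_zero).finrank, AdjoinRoot.powerBasis_dim, hdeg]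
  have : Module.Finite (ZMod p) (AdjoinRoot q) := (AdjoinRoot.powerBasis hirr.ne_zero).finite
  have hcard : Nat.card (AdjoinRoot q) = p ^ 2 := by
    rw [Module.natCard_eq_pow_finrank (K := ZMod p), Nat.card_zmod, hfin]
  let e := GaloisField.algEquivGaloisField p 2 hcard
  let φ : AdjoinRoot q →+* Matrix (Fin 2) (Fin 2) (ZMod p) :=
    Ideal.Quotient.lift _ (Polynomial.aeval h.1 : Polynomial (ZMod p) →ₐ[ZMod p] _).toRingHom (by
      intro r hr
      obtain ⟨s, rfl⟩ := Ideal.mem_span_singleton.mp hr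
      simp [hq, Matrix.aeval_self_charpoly])
  have hφ : ∀ r, φ (AdjoinRoot.mk q r) = Polynomial.aeval h.1 r := fun r => rfl
  refine ⟨φ.comp e.symm.toRingEquiv.toRingHom, fun u => ?_⟩
  rw [Subgroup.mem_centralizer_singleton_iff]
  constructor
  · intro hu
    obtain ⟨x, y, hxy⟩ := Matrix.exists_eq_smul_one_add_smul_of_commute
      (Commute.map hu.symm (Units.coeHom _)) hns
    have hval : u.1 = φ.comp e.symm.toRingEquiv.toRingHom
        (e (AdjoinRoot.mk q (Polynomial.C x + Polynomial.C y * Polynomial.X))) := by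
      trans φ (AdjoinRoot.mk q (Polynomial.C x + Polynomial.C y * Polynomial.X))
      · rw [hφ, map_add, map_mul, Polynomial.aeval_C, Polynomial.aeval_C, Polynomial.aeval_X,
          ← Algebra.smul_def, Algebra.algebraMap_eq_smul_one]
        exact hxy
      · exact congr_arg φ (e.symm_apply_apply _).symm
    refine ⟨_, ?_, hval⟩
    intro h0
    rw [h0, map_zero] at hval
    exact u.ne_zero hval
  · rintro ⟨x, -, hx⟩
    obtain ⟨r, hr⟩ := AdjoinRoot.mk_surjective (e.symm x)
    have hur : u.1 = Polynomial.aeval h.1 r := by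
      rw [hx, ← hφ, hr]
      rfl
    refine Units.ext ?_
    rw [Units.val_mul, Units.val_mul, hur]
    simpa using congr_arg (Polynomial.aeval h.1) (mul_comm r Polynomial.X)

end Cartan

section AbsolutelyIrreducible

variable {p : ℕ} [Fact p.Prime]

local notation "K" => AlgebraicClosure (ZMod p)

/-- A normal subgroup of an absolutely irreducible group that is itself absolutely reducible is
simultaneously diagonalizable over the algebraic closure. -/
theorem IsAbsolutelyIrreducible.exists_conj_diagonal {G N : Subgroup (GL (Fin 2) (ZMod p))}
    (hG : IsAbsolutelyIrreducible p G) (hN : ¬ IsAbsolutelyIrreducible p N)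
    (hconj : ∀ g ∈ G, ∀ n ∈ N, g⁻¹ * n * g ∈ N) :
    ∃ P : Matrix (Fin 2) (Fin 2) K, P.det ≠ 0 ∧ ∀ n ∈ N, ∃ a b : K,
      n.1.map (algebraMap (ZMod p) K) = P * diagonal ![a, b] * P⁻¹ := by
  simp only [IsAbsolutelyIrreducible, not_forall, not_or] at hN
  obtain ⟨W, hW, hbot, htop⟩ := hN
  have hnot : ¬ ∀ g ∈ G, ∀ w ∈ W, (g.1.map (algebraMap (ZMod p) K)) *ᵥ w ∈ W :=
    fun h => (hG W h).elim hbot htop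
  push Not at hnot
  obtain ⟨g, hg, w, hw, hgw⟩ := hnot
  set v := (g.1.map (algebraMap (ZMod p) K)) *ᵥ w with hv
  set P : Matrix (Fin 2) (Fin 2) K := (of ![w, v])ᵀ with hP
  have hPmul : ∀ u : Fin 2 → K, P *ᵥ u = u 0 • w + u 1 • v := by
    intro u
    ext i
    simp [hP, mulVec, dotProduct, mul_comm]
  have hcoord : ∀ u : Fin 2 → K, P *ᵥ u ∈ W → u 1 = 0 := by
    intro u hu
    by_contra h1
    rw [hPmul, W.add_mem_iff_right (W.smul_mem _ hw), W.smul_mem_iff h1] at hu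
    exact hgw hu
  have hw0 : w ≠ 0 := by
    rintro rfl
    exact hgw (by simp [hv])
  have hdet : P.det ≠ 0 := by
    intro h0
    obtain ⟨u, hu, hu'⟩ := exists_mulVec_eq_zero_iff.mpr h0
    have h1 := hcoord u (hu' ▸ W.zero_mem)
    rw [hPmul, h1, zero_smul, add_zero, smul_eq_zero, or_iff_left hw0] at hu'
    exact hu (by ext i; fin_cases i <;> assumption)
  have hPu : IsUnit P.det := isUnit_iff_ne_zero.mpr hdet
  have hline : ∀ n ∈ N, ∃ a : K, (n.1.map (algebraMap (ZMod p) K)) *ᵥ w = a • w := by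
    intro n hn
    have hx := hW n hn w hw
    have hPx : P *ᵥ (P⁻¹ *ᵥ ((n.1.map (algebraMap (ZMod p) K)) *ᵥ w)) =
        (n.1.map (algebraMap (ZMod p) K)) *ᵥ w := by
      rw [mulVec_mulVec, mul_nonsing_inv _ hPu, one_mulVec]
    refine ⟨(P⁻¹ *ᵥ ((n.1.map (algebraMap (ZMod p) K)) *ᵥ w)) 0, ?_⟩
    have h1 := hcoord _ (hPx.symm ▸ hx)
    rw [hPmul, h1, zero_smul, add_zero] at hPx
    exact hPx.symm
  refine ⟨P, hdet, fun n hn => ?_⟩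
  obtain ⟨a, ha⟩ := hline n hn
  obtain ⟨b, hb⟩ := hline _ (hconj g hg n hn)
  have hb' : (n.1.map (algebraMap (ZMod p) K)) *ᵥ v = b • v := by
    rw [hv, ← mulVec_smul, ← hb, mulVec_mulVec, mulVec_mulVec, ← Matrix.map_mul, ← Matrix.map_mul,
      ← Units.val_mul, ← Units.val_mul, mul_assoc g⁻¹, mul_inv_cancel_left]
  refine ⟨a, b, ?_⟩
  have hmul : n.1.map (algebraMap (ZMod p) K) * P = P * diagonal ![a, b] := by
    ext i j
    have ha' := congr_fun ha i
    have hb'' := congr_fun hb' i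
    fin_cases j
    · simpa [hP, mul_apply, mulVec, dotProduct, mul_comm] using ha'
    · simpa [hP, mul_apply, mulVec, dotProduct, mul_comm] using hb''
  rw [← hmul, mul_assoc, mul_nonsing_inv _ hPu, mul_one]

/-- If the determinant-one part of an absolutely irreducible group consisted of scalars, the group
would be generated by scalars and one further matrix, hence would stabilize a line. -/
theorem IsAbsolutelyIrreducible.exists_nonscalar {G : Subgroup (GL (Fin 2) (ZMod p))}
    (hG : IsAbsolutelyIrreducible p G)
    (hdet : ∀ a : (ZMod p)ˣ, ∃ g ∈ G, Matrix.GeneralLinearGroup.det g = a) :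
    ∃ h ∈ G ⊓ SL2 p, ∀ c : ZMod p, h.1 ≠ scalar (Fin 2) c := by
  by_contra! hscalar
  obtain ⟨d, hd⟩ := IsCyclic.exists_monoid_generator (α := (ZMod p)ˣ)
  obtain ⟨g, hg, hgd⟩ := hdet d
  obtain ⟨c, hc⟩ := Module.End.exists_eigenvalue (toLin' (g.1.map (algebraMap (ZMod p) K)))
  obtain ⟨v, hv⟩ := hc.exists_hasEigenvector
  have hgv : (g.1.map (algebraMap (ZMod p) K)) *ᵥ v ∈ Submodule.span K {v} := by
    rw [← toLin'_apply, hv.apply_eq_smul]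
    exact Submodule.smul_mem _ _ (Submodule.mem_span_singleton_self v)
  have hstep : ∀ u : GL (Fin 2) (ZMod p),
      (u.1.map (algebraMap (ZMod p) K)) *ᵥ v ∈ Submodule.span K {v} → ∀ w ∈ Submodule.span K {v},
        (u.1.map (algebraMap (ZMod p) K)) *ᵥ w ∈ Submodule.span K {v} := by
    intro u hu w hw
    obtain ⟨x, rfl⟩ := Submodule.mem_span_singleton.mp hw
    rw [mulVec_smul]
    exact Submodule.smul_mem _ _ hu
  have hpow : ∀ n : ℕ, ∀ w ∈ Submodule.span K {v},
      ((g ^ n).1.map (algebraMap (ZMod p) K)) *ᵥ w ∈ Submodule.span K {v} := by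
    intro n
    induction n with
    | zero => intro w hw; simpa using hw
    | succ n ih =>
      intro w hw
      rw [pow_succ, Units.val_mul, Matrix.map_mul, ← mulVec_mulVec]
      exact ih _ (hstep g hgv w hw)
  rcases hG (Submodule.span K {v}) (by
    intro u hu w hw
    obtain ⟨n, hn⟩ := Submonoid.mem_powers_iff _ _ |>.mp (hd (Matrix.GeneralLinearGroup.det u))
    obtain ⟨x, hx⟩ := hscalar ((g ^ n)⁻¹ * u)
      ⟨G.mul_mem (G.inv_mem (G.pow_mem hg n)) hu, by simp [SL2, hgd, ← hn]⟩
    have hu' : u.1 = (g ^ n).1 * scalar (Fin 2) x := by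
      rw [← hx, ← Units.val_mul, mul_inv_cancel_left]
    have hxw : (scalar (Fin 2) x).map (algebraMap (ZMod p) K) *ᵥ w =
        algebraMap (ZMod p) K x • w := by
      ext i
      fin_cases i <;> simp [mulVec, dotProduct]
    rw [hu', Matrix.map_mul, ← mulVec_mulVec, hxw]
    exact hpow n _ (Submodule.smul_mem _ _ hw)) with hbot | htop
  · exact hv.2 (Submodule.span_singleton_eq_bot.mp hbot)
  · have h1 : Module.finrank K (Submodule.span K {v}) = 1 := finrank_span_singleton hv.2
    rw [htop, finrank_top, Module.finrank_fin_fun] at h1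
    omega

end AbsolutelyIrreducible

/-- Let `p ≥ 3` be a prime and `G` an absolutely irreducible subgroup of `GL₂(𝔽_p)` such that
`G ∩ SL₂(𝔽_p)` is absolutely reducible and `det G = 𝔽_p*`. Then `G ∩ GL₂⁺(𝔽_p)` is contained in
a Cartan subgroup, where `GL₂⁺(𝔽_p)` is the subgroup of matrices with square determinant. -/
theorem absolutelyIrreducible_inf_GL2plus_le_cartan
    (p : ℕ) [Fact p.Prime] (hp3 : 3 ≤ p) (G : Subgroup (GL (Fin 2) (ZMod p)))
    (hG : IsAbsolutelyIrreducible p G)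
    (hG' : ¬ IsAbsolutelyIrreducible p (G ⊓ SL2 p))
    (hdet : ∀ a : (ZMod p)ˣ, ∃ g ∈ G, Matrix.GeneralLinearGroup.det g = a) :
    ∃ C : Subgroup (GL (Fin 2) (ZMod p)), IsCartan p C ∧ G ⊓ GL2plus p ≤ C := by
  obtain ⟨h, hh, hns⟩ := hG.exists_nonscalar hdet
  have hconj : ∀ g ∈ G, ∀ n ∈ G ⊓ SL2 p, g * n * g⁻¹ ∈ G ⊓ SL2 p := fun g hg n hn =>
    ⟨G.mul_mem (G.mul_mem hg hn.1) (G.inv_mem hg), (MonoidHom.normal_ker _).conj_mem n hn.2 g⟩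
  obtain ⟨P, hP, hdiag⟩ := hG.exists_conj_diagonal hG' fun g hg n hn => by
    simpa using hconj g⁻¹ (inv_mem hg) n hn
  have hinj : Function.Injective (algebraMap (ZMod p) (AlgebraicClosure (ZMod p))) :=
    (algebraMap (ZMod p) (AlgebraicClosure (ZMod p))).injective
  have hcomm : ∀ m ∈ G ⊓ SL2 p, ∀ n ∈ G ⊓ SL2 p, Commute m.1 n.1 := by
    intro m hm n hn
    apply Matrix.map_injective hinj
    obtain ⟨a, b, hab⟩ := hdiag m hm
    obtain ⟨c, d, hcd⟩ := hdiag n hn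
    have hPP : P⁻¹ * P = 1 := nonsing_inv_mul _ (isUnit_iff_ne_zero.mpr hP)
    simp only [Matrix.map_mul, hab, hcd]
    calc P * diagonal ![a, b] * P⁻¹ * (P * diagonal ![c, d] * P⁻¹)
        = P * (diagonal ![a, b] * (P⁻¹ * P) * diagonal ![c, d]) * P⁻¹ := by simp only [mul_assoc]
      _ = P * (diagonal ![c, d] * (P⁻¹ * P) * diagonal ![a, b]) * P⁻¹ := by
        rw [hPP, mul_one, mul_one, (commute_diagonal _ _).eq]
      _ = P * diagonal ![c, d] * P⁻¹ * (P * diagonal ![a, b] * P⁻¹) := by simp only [mul_assoc]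
  have hdisc : h.1.trace ^ 2 - 4 * h.1.det ≠ 0 := by
    obtain ⟨a, b, hab⟩ := hdiag h hh
    have hne := discr_ne_zero_of_eq_conj_diagonal hP hab (by
      intro c hc
      have hc' : ∀ i j, algebraMap (ZMod p) (AlgebraicClosure (ZMod p)) (h.1 i j) =
          scalar (Fin 2) c i j := congr_fun₂ hc
      apply hns (h.1 0 0)
      ext i j
      apply hinj
      fin_cases i <;> fin_cases j <;> simp [hc'])
    intro h0
    apply hne
    rw [← map_zero (algebraMap (ZMod p) (AlgebraicClosure (ZMod p))), ← h0]
    simp only [trace_fin_two, det_fin_two, map_apply, map_sub, map_mul, map_add, map_pow]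
    rw [map_ofNat]
  have h2 : (2 : ZMod p) ≠ 0 := by
    apply Ring.two_ne_zero
    rw [ZMod.ringChar_zmod_n]
    omega
  refine ⟨Subgroup.centralizer {h}, ?_, ?_⟩
  · by_cases hroot : ∃ a : ZMod p, a ^ 2 - h.1.trace * a + h.1.det = 0
    · obtain ⟨a, ha⟩ := hroot
      exact Or.inl (isSplitCartan_centralizer hdisc ha)
    · exact Or.inr (isNonsplitCartan_centralizer (not_exists.mp hroot))
  · rintro u ⟨huG, d, hd⟩
    obtain ⟨k, hk, rfl⟩ := hdet d
    have hn : (k * k)⁻¹ * u ∈ G ⊓ SL2 p := by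
      refine ⟨G.mul_mem (G.inv_mem (G.mul_mem hk hk)) huG, ?_⟩
      change Matrix.GeneralLinearGroup.det ((k * k)⁻¹ * u) = 1
      rw [map_mul, ← hd, map_inv, map_mul, powMonoidHom_apply, pow_two,
        inv_mul_cancel]
    have hkk : Commute (k * k) h := Units.ext <| commute_mul_self_of_commute_conj h2
      ((isUnit_iff_isUnit_det _).mp k.isUnit).ne_zero hns hdisc (by
        have := hcomm h hh _ (hconj k hk h hh)
        rwa [Units.val_mul, Units.val_mul, coe_units_inv] at this)
    have hnh : Commute ((k * k)⁻¹ * u) h := Units.ext (hcomm _ hn h hh)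
    rw [Subgroup.mem_centralizer_singleton_iff]
    have := hkk.mul_left hnh
    rw [mul_inv_cancel_left] at this
    exact this.eq
end

section
/- The elliptic curve E over ℚ given by the Weierstrass equation y² + xy + y = x³ + x² − 10x − 10 (Cremona label 15A1) has Mordell–Weil group E(ℚ) isomorphic to ℤ/4ℤ × ℤ/2ℤ, with exactly the eight rational points ∞, (−1,0), (−2,−2), (8,−27), (3,−2), (−13/4, 9/8), (−2,3), (8,18). -/
/-- The elliptic curve `y² + xy + y = x³ + x² − 10x − 10` over `ℚ` (Cremona label 15A1). -/
def E15A1 : WeierstrassCurve ℚ :=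
  { a₁ := 1, a₂ := 1, a₃ := 1, a₄ := -10, a₆ := -10 }

theorem Int.exists_eq_squarefree_mul_sq {n : ℤ} (hn : n ≠ 0) :
    ∃ d r : ℤ, n = d * r ^ 2 ∧ Squarefree d ∧ r ≠ 0 := by
  obtain ⟨a, b, h, ha⟩ := Nat.sq_mul_squarefree n.natAbs
  have hb : b ≠ 0 := by
    rintro rfl
    apply hn
    rw [← Int.natAbs_eq_zero, ← h]
    simp
  have hb' : (b : ℤ) ≠ 0 := by exact_mod_cast hb
  have h' : (b : ℤ) ^ 2 * a = |n| := by
    rw [Int.abs_eq_natAbs, ← h]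
    push_cast
    ring
  have hsq : Squarefree (a : ℤ) := Int.squarefree_natCast.2 ha
  rcases abs_choice n with hc | hc
  · exact ⟨a, b, by rw [← hc, ← h']; ring, hsq, hb'⟩
  · refine ⟨-a, b, by linarith, ?_, hb'⟩
    rwa [← Int.squarefree_natAbs, Int.natAbs_neg, Int.squarefree_natAbs]

theorem Int.dvd_of_squarefree_mul_sq_mul_eq_sq {d r k w : ℤ} (hd : Squarefree d) (hr : r ≠ 0)
    (h : d * r ^ 2 * k = w ^ 2) : d ∣ k := by
  obtain ⟨w', rfl⟩ : r ∣ w :=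
    (Int.pow_dvd_pow_iff two_ne_zero).1 ⟨d * k, by rw [← h]; ring⟩
  have h1 : d * k = w' ^ 2 :=
    mul_left_cancel₀ (pow_ne_zero 2 hr) (by linear_combination h)
  obtain ⟨z, rfl⟩ : d ∣ w' := (hd.dvd_pow_iff_dvd two_ne_zero).1 ⟨k, h1.symm⟩
  have hd0 : d ≠ 0 := hd.ne_zero
  exact ⟨z ^ 2, mul_left_cancel₀ hd0 (by linear_combination h1)⟩

/-- If `n * (n + A * f ^ 2) * (n + B * f ^ 2)` is a square and `n`, `f` are coprime, then the
squarefree part of `n` divides every `c` some power of which is divisible by `A * B`. -/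
theorem squarefreePart_dvd {n d r f w A B c : ℤ} (hd : Squarefree d) (hr : r ≠ 0)
    (hn : n = d * r ^ 2) (hf : IsCoprime n f)
    (h : n * (n + A * f ^ 2) * (n + B * f ^ 2) = w ^ 2) (hc : A * B ∣ c ^ 4) : d ∣ c := by
  have hdn : d ∣ n := ⟨r ^ 2, hn⟩
  have hk : d ∣ (n + A * f ^ 2) * (n + B * f ^ 2) :=
    Int.dvd_of_squarefree_mul_sq_mul_eq_sq hd hr (by rw [← hn, ← mul_assoc, h])
  have h1 : d ∣ A * B * f ^ 4 := by
    have : A * B * f ^ 4 = (n + A * f ^ 2) * (n + B * f ^ 2) - n * (n + (A + B) * f ^ 2) := by ring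
    rw [this]
    exact dvd_sub hk (hdn.mul_right _)
  have h2 : d ∣ A * B :=
    ((hf.of_isCoprime_of_dvd_left hdn).pow_right (n := 4)).dvd_of_dvd_mul_right h1
  exact (hd.dvd_pow_iff_dvd four_ne_zero).1 (h2.trans hc)

theorem Int.mem_of_dvd_six {d : ℤ} (h : d ∣ 6) : d ∈ [1, -1, 2, -2, 3, -3, 6, -6] := by
  have h1 := Int.le_of_dvd (by norm_num) h
  have h2 := Int.le_of_dvd (by norm_num) ((neg_dvd).2 h)
  have h3 : -6 ≤ d := by omega
  interval_cases d <;> revert h <;> decide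

theorem Int.mem_of_dvd_ten {d : ℤ} (h : d ∣ 10) : d ∈ [1, -1, 2, -2, 5, -5, 10, -10] := by
  have h1 := Int.le_of_dvd (by norm_num) h
  have h2 := Int.le_of_dvd (by norm_num) ((neg_dvd).2 h)
  have h3 : -10 ≤ d := by omega
  interval_cases d <;> revert h <;> decide

theorem Int.mem_of_dvd_fifteen {d : ℤ} (h : d ∣ 15) (hd : 0 < d) : d ∈ [1, 3, 5, 15] := by
  have h1 := Int.le_of_dvd (by norm_num) h
  interval_cases d <;> revert h <;> decide

theorem squareClass_mem : ∀ d₁ ∈ [1, -1, 2, -2, 3, -3, 6, -6],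
    ∀ d₂ ∈ [1, -1, 2, -2, 5, -5, 10, -10],
    ∀ d₃ ∈ [1, 3, 5, (15 : ℤ)], IsSquare (d₁ * d₂ * d₃) →
      ∃ ε ∈ [1, -1], ∃ α ∈ [1, 2], ∃ β ∈ [1, 3], ∃ γ ∈ [1, 5],
        d₁ = ε * α * β ∧ d₂ = ε * α * γ ∧ d₃ = β * γ := by
  decide +kernel

theorem no_solution_at_three {e k r s t f : ℤ} (he : ¬ 3 ∣ e) (hk : ¬ 3 ∣ k) (hf : ¬ 3 ∣ f)
    (h₁ : e * r ^ 2 + 3 * f ^ 2 = k * t ^ 2) (h₂ : 3 * e * r ^ 2 - 16 * f ^ 2 = e * k * s ^ 2) :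
    False := by
  have hr : ¬ 3 ∣ r := by
    rintro ⟨r', rfl⟩
    have h3 : (3 : ℤ) ∣ k * t ^ 2 := ⟨3 * e * r' ^ 2 + f ^ 2, by rw [← h₁]; ring⟩
    obtain ⟨t', rfl⟩ : (3 : ℤ) ∣ t :=
      Int.prime_three.dvd_of_dvd_pow ((Int.prime_three.dvd_or_dvd h3).resolve_left hk)
    exact hf (Int.prime_three.dvd_of_dvd_pow (n := 2) ⟨k * t' ^ 2 - e * r' ^ 2, by linarith⟩)
  have key₁ : ∀ e k r t : ZMod 3, e ≠ 0 → k ≠ 0 → r ≠ 0 → e * r ^ 2 = k * t ^ 2 → e * k = 1 := by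
    decide
  have key₂ : ∀ s f : ZMod 3, f ≠ 0 → -f ^ 2 ≠ 1 * s ^ 2 := by decide
  have c (n : ℤ) (hn : ¬ 3 ∣ n) : (n : ZMod 3) ≠ 0 := fun h ↦
    hn ((ZMod.intCast_zmod_eq_zero_iff_dvd n 3).1 h)
  have z : (3 : ZMod 3) = 0 := by decide
  have g₁ := congrArg (Int.cast : ℤ → ZMod 3) h₁
  have g₂ := congrArg (Int.cast : ℤ → ZMod 3) h₂
  push_cast at g₁ g₂
  have hek := key₁ e k r t (c e he) (c k hk) (c r hr) (by linear_combination g₁ - f ^ 2 * z)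
  refine key₂ s f (c f hf) ?_
  rw [← hek]
  linear_combination g₂ - (e * r ^ 2 - 5 * f ^ 2) * z

theorem no_solution_at_two {e k r s t f : ℤ} (he : e = 1 ∨ e = -1) (hk : k = 1 ∨ k = 5)
    (hf : ¬ 2 ∣ f) (h₁ : 2 * e * r ^ 2 + 9 * f ^ 2 = k * t ^ 2)
    (h₂ : e * r ^ 2 - 8 * f ^ 2 = e * k * s ^ 2) : False := by
  obtain ⟨g, rfl⟩ : ∃ g, f = 2 * g + 1 := ⟨f / 2, by omega⟩
  obtain ⟨j, hj⟩ := Int.even_mul_succ_self g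
  have hg : (2 * g + 1) ^ 2 = 8 * j + 1 := by linear_combination 4 * hj
  rw [hg] at h₁ h₂
  have key₁ : ∀ e k r t : ZMod 8, e = 1 ∨ e = -1 → k = 1 ∨ k = 5 →
      2 * e * r ^ 2 + 1 = k * t ^ 2 → k = 1 ∧ 2 * r ^ 2 = 0 := by decide
  have z : (8 : ZMod 8) = 0 := by decide
  have g₁ := congrArg (Int.cast : ℤ → ZMod 8) h₁
  push_cast at g₁
  obtain ⟨hk1, hr⟩ := key₁ e k r t (by rcases he with rfl | rfl <;> simp)
    (by rcases hk with rfl | rfl <;> simp) (by linear_combination g₁ - (9 * j + 1) * z)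
  have hk2 : k = 1 := by
    rcases hk with rfl | rfl
    · rfl
    · exact absurd hk1 (by decide)
  subst hk2
  have hr2 : (8 : ℤ) ∣ 2 * r ^ 2 := by
    refine (ZMod.intCast_zmod_eq_zero_iff_dvd _ 8).1 ?_
    push_cast
    exact hr
  obtain ⟨r', rfl⟩ : (2 : ℤ) ∣ r := Int.prime_two.dvd_of_dvd_pow (n := 2) (by omega)
  have key₂ : ∀ e r s : ZMod 16, e = 1 ∨ e = -1 → 4 * e * r ^ 2 - 8 ≠ e * s ^ 2 := by decide
  have g₂ := congrArg (Int.cast : ℤ → ZMod 16) h₂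
  push_cast at g₂
  have z' : (16 : ZMod 16) = 0 := by decide
  exact key₂ e r' s (by rcases he with rfl | rfl <;> simp)
    (by linear_combination g₂ + 4 * j * z')

theorem squareClasses_of_coprime {m f w : ℤ} (hmf : IsCoprime m f) (hw : w ≠ 0)
    (h : m * (m - 16 * f ^ 2) * (m + 9 * f ^ 2) = w ^ 2) :
    ∃ ε γ r s t : ℤ, (ε = 1 ∨ ε = -1) ∧ (γ = 1 ∨ γ = 5) ∧ m = ε * r ^ 2 ∧
      m - 16 * f ^ 2 = ε * γ * s ^ 2 ∧ m + 9 * f ^ 2 = γ * t ^ 2 := by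
  have hw2 : 0 < w ^ 2 := by positivity
  have hm : m * (m - 16 * f ^ 2) * (m + 9 * f ^ 2) ≠ 0 := h ▸ hw2.ne'
  have hm3 : m + 9 * f ^ 2 ≠ 0 := right_ne_zero_of_mul hm
  have hm2 : m - 16 * f ^ 2 ≠ 0 := right_ne_zero_of_mul (left_ne_zero_of_mul hm)
  have hm1 : m ≠ 0 := left_ne_zero_of_mul (left_ne_zero_of_mul hm)
  obtain ⟨d₁, r, h₁, hd₁, hr⟩ := Int.exists_eq_squarefree_mul_sq hm1
  obtain ⟨d₂, s, h₂, hd₂, hs⟩ := Int.exists_eq_squarefree_mul_sq hm2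
  obtain ⟨d₃, t, h₃, hd₃, ht⟩ := Int.exists_eq_squarefree_mul_sq hm3
  have hc2 : IsCoprime (m - 16 * f ^ 2) f := by
    rw [show m - 16 * f ^ 2 = m + f * (-16 * f) by ring]
    exact hmf.add_mul_left_left _
  have hc3 : IsCoprime (m + 9 * f ^ 2) f := by
    rw [show m + 9 * f ^ 2 = m + f * (9 * f) by ring]
    exact hmf.add_mul_left_left _
  have hd6 : d₁ ∣ 6 := squarefreePart_dvd (A := -16) (B := 9) hd₁ hr h₁ hmf
    (by rw [← h]; ring) (by norm_num)
  have hd10 : d₂ ∣ 10 := squarefreePart_dvd (A := 16) (B := 25) hd₂ hs h₂ hc2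
    (by rw [← h]; ring) (by norm_num)
  have hd15 : d₃ ∣ 15 := squarefreePart_dvd (A := -9) (B := -25) hd₃ ht h₃ hc3
    (by rw [← h]; ring) (by norm_num)
  have hpos : 0 < d₃ := by
    have : 0 < m + 9 * f ^ 2 := by
      by_contra! hle
      have hf2 := sq_nonneg f
      have : 0 ≤ m * (m - 16 * f ^ 2) := mul_nonneg_of_nonpos_of_nonpos (by linarith) (by linarith)
      nlinarith
    rw [h₃] at this
    exact pos_of_mul_pos_left this (sq_nonneg t)
  have hsq : IsSquare (d₁ * d₂ * d₃) := by
    have h4 : d₁ * d₂ * d₃ * (r * s * t) ^ 2 = w ^ 2 := by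
      rw [← h, h₃, h₂, h₁]
      ring
    obtain ⟨k, rfl⟩ : r * s * t ∣ w :=
      (Int.pow_dvd_pow_iff two_ne_zero).1 ⟨d₁ * d₂ * d₃, by rw [← h4]; ring⟩
    refine ⟨k, mul_right_cancel₀ (pow_ne_zero 2 (mul_ne_zero (mul_ne_zero hr hs) ht)) ?_⟩
    rw [h4]
    ring
  obtain ⟨ε, hε, α, hα, β, hβ, γ, hγ, rfl, rfl, rfl⟩ := squareClass_mem d₁ (Int.mem_of_dvd_six hd6)
    d₂ (Int.mem_of_dvd_ten hd10) d₃ (Int.mem_of_dvd_fifteen hd15 hpos) hsq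
  simp only [List.mem_cons, List.not_mem_nil, or_false] at hε hα hβ hγ
  have hβ1 : β = 1 := by
    refine hβ.resolve_right ?_
    rintro rfl
    refine no_solution_at_three (e := ε * α) (k := γ) (r := r) (s := s) (t := t) (f := f)
      (by rcases hε with rfl | rfl <;> rcases hα with rfl | rfl <;> decide)
      (by rcases hγ with rfl | rfl <;> decide) ?_ (by linarith) (by linarith)
    intro h3f
    exact Int.prime_three.not_isUnit (hmf.isUnit_of_dvd' ⟨ε * α * r ^ 2, by rw [h₁]; ring⟩ h3f)
  subst hβ1
  have hα1 : α = 1 := by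
    refine hα.resolve_right ?_
    rintro rfl
    refine no_solution_at_two (e := ε) (k := γ) (r := r) (s := s) (t := t) (f := f)
      hε hγ ?_ (by linarith) (by linarith)
    intro h2f
    exact Int.prime_two.not_isUnit (hmf.isUnit_of_dvd' ⟨ε * r ^ 2, by rw [h₁]; ring⟩ h2f)
  subst hα1
  exact ⟨ε, γ, r, s, t, hε, hγ, by rw [h₁]; ring, by rw [h₂]; ring, by rw [h₃]; ring⟩

theorem squareClasses_of_sq_eq {x v : ℚ} (hv : v ≠ 0)
    (h : v ^ 2 = (x + 1) * (x - 3) * (4 * x + 13)) :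
    ∃ ε γ a b c : ℚ, (ε = 1 ∨ ε = -1) ∧ (γ = 1 ∨ γ = 5) ∧ x + 1 = ε * a ^ 2 ∧
      x - 3 = ε * γ * b ^ 2 ∧ 4 * x + 13 = γ * c ^ 2 := by
  set u : ℚ := 4 * (x + 1) with hu
  have he : (u.den : ℚ) ≠ 0 := by exact_mod_cast u.den_ne_zero
  have hm : (u.num : ℚ) = u * u.den := (Rat.mul_den_eq_num u).symm
  have hsq : (u.num * (u.num - 16 * u.den) * (u.num + 9 * u.den) * u.den : ℚ) =
      (4 * v * u.den ^ 2) ^ 2 := by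
    rw [hm, hu]
    linear_combination (-16 * (u.den : ℚ) ^ 4) * h
  obtain ⟨w, hw⟩ : IsSquare (u.num * (u.num - 16 * u.den) * (u.num + 9 * u.den) * u.den : ℤ) := by
    rw [← Rat.isSquare_intCast_iff]
    exact ⟨4 * v * u.den ^ 2, by push_cast; rw [hsq]; ring⟩
  have hcop : IsCoprime u.num (u.den : ℤ) := by
    rw [Int.isCoprime_iff_nat_coprime]
    exact u.reduced
  have hcop3 : IsCoprime (u.num * (u.num - 16 * u.den) * (u.num + 9 * u.den)) (u.den : ℤ) := by
    refine (hcop.mul_left ?_).mul_left ?_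
    · rw [sub_eq_add_neg, ← neg_mul]
      exact hcop.add_mul_right_left _
    · exact hcop.add_mul_right_left _
  obtain ⟨f, hf⟩ : ∃ f : ℤ, (u.den : ℤ) = f ^ 2 := by
    obtain ⟨f, hf | hf⟩ := Int.sq_of_gcd_eq_one (a := u.den)
      (b := u.num * (u.num - 16 * u.den) * (u.num + 9 * u.den)) (c := w)
      (Int.isCoprime_iff_gcd_eq_one.1 hcop3.symm) (by rw [mul_comm, hw, sq])
    · exact ⟨f, hf⟩
    · have := u.den_pos
      have := sq_nonneg f
      omega
  have hf0 : f ≠ 0 := by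
    rintro rfl
    exact u.den_ne_zero (by simp at hf)
  have hw0 : w ≠ 0 := by
    rintro rfl
    have hw' := congrArg (Int.cast : ℤ → ℚ) hw
    push_cast at hw'
    rw [hsq] at hw'
    have : 4 * v * (u.den : ℚ) ^ 2 ≠ 0 := by positivity
    exact pow_ne_zero 2 this (by simpa using hw')
  rw [hf] at hw hcop
  obtain ⟨w', rfl⟩ : f ∣ w := by
    refine (Int.pow_dvd_pow_iff two_ne_zero).1
      ⟨u.num * (u.num - 16 * f ^ 2) * (u.num + 9 * f ^ 2), by rw [sq w, ← hw]; ring⟩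
  obtain ⟨ε, γ, r, s, t, hε, hγ, h₁, h₂, h₃⟩ := squareClasses_of_coprime (m := u.num) (f := f)
    (w := w') ((IsCoprime.pow_right_iff two_pos).1 hcop) (right_ne_zero_of_mul hw0)
    (mul_right_cancel₀ (pow_ne_zero 2 hf0) (by rw [hw]; ring))
  have hfq : (f : ℚ) ≠ 0 := by exact_mod_cast hf0
  have hden : (u.den : ℚ) = f ^ 2 := by exact_mod_cast hf
  have g₁ := congrArg (Int.cast : ℤ → ℚ) h₁
  have g₂ := congrArg (Int.cast : ℤ → ℚ) h₂
  have g₃ := congrArg (Int.cast : ℤ → ℚ) h₃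
  push_cast at g₁ g₂ g₃
  rw [hm, hden, hu] at g₁ g₂ g₃
  refine ⟨ε, γ, r / (2 * f), s / (2 * f), t / f, by exact_mod_cast hε, by exact_mod_cast hγ,
    ?_, ?_, ?_⟩
  · field_simp
    linear_combination g₁
  · field_simp
    linear_combination g₂
  · field_simp
    linear_combination g₃

namespace E15A1

open WeierstrassCurve.Affine

theorem equation_iff {x y : ℚ} :
    E15A1.toAffine.Equation x y ↔ (2 * y + x + 1) ^ 2 = (x + 1) * (x - 3) * (4 * x + 13) := by
  rw [WeierstrassCurve.Affine.equation_iff]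
  simp only [E15A1]
  constructor <;> intro h
  · linear_combination 4 * h
  · linear_combination h / 4

theorem nonsingular_iff {x y : ℚ} :
    E15A1.toAffine.Nonsingular x y ↔ (2 * y + x + 1) ^ 2 = (x + 1) * (x - 3) * (4 * x + 13) := by
  rw [← equation_iff, equation_iff_nonsingular_of_Δ_ne_zero]
  norm_num [E15A1, WeierstrassCurve.Δ, WeierstrassCurve.b₂, WeierstrassCurve.b₄,
    WeierstrassCurve.b₆, WeierstrassCurve.b₈]

theorem negY_eq (x y : ℚ) : E15A1.toAffine.negY x y = -y - x - 1 := by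
  simp [negY, E15A1]

/-- Addition of points joined by a line of slope `l` (a chord or a tangent). -/
theorem add_some_eq {x₁ y₁ x₂ y₂ l : ℚ} (h₁ : E15A1.toAffine.Nonsingular x₁ y₁)
    (h₂ : E15A1.toAffine.Nonsingular x₂ y₂) (hxy : ¬(x₁ = x₂ ∧ y₁ = -y₂ - x₂ - 1))
    (hl : E15A1.toAffine.slope x₁ x₂ y₁ y₂ = l) :
    ∃ h, Point.some x₁ y₁ h₁ + .some x₂ y₂ h₂ =
      .some (l ^ 2 + l - 1 - x₁ - x₂)
        (-(l * (l ^ 2 + l - 1 - x₁ - x₂ - x₁) + y₁) - (l ^ 2 + l - 1 - x₁ - x₂) - 1) h := by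
  subst hl
  have hxy' : ¬(x₁ = x₂ ∧ y₁ = E15A1.toAffine.negY x₂ y₂) := by rwa [negY_eq]
  have hX : E15A1.toAffine.addX x₁ x₂ (E15A1.toAffine.slope x₁ x₂ y₁ y₂) =
      E15A1.toAffine.slope x₁ x₂ y₁ y₂ ^ 2 + E15A1.toAffine.slope x₁ x₂ y₁ y₂ - 1 - x₁ - x₂ := by
    simp [addX, E15A1]
  have h := nonsingular_add h₁ h₂ hxy'
  simp only [addY, negAddY, negY_eq, hX] at h
  refine ⟨h, ?_⟩
  rw [Point.add_some hxy', Point.some.injEq]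
  simp only [addY, negAddY, negY_eq, hX, and_self]

theorem add_of_X_ne {x₁ y₁ x₂ y₂ l : ℚ} (h₁ : E15A1.toAffine.Nonsingular x₁ y₁)
    (h₂ : E15A1.toAffine.Nonsingular x₂ y₂) (hx : x₁ ≠ x₂) (hl : l * (x₁ - x₂) = y₁ - y₂) :
    ∃ h, Point.some x₁ y₁ h₁ + .some x₂ y₂ h₂ =
      .some (l ^ 2 + l - 1 - x₁ - x₂)
        (-(l * (l ^ 2 + l - 1 - x₁ - x₂ - x₁) + y₁) - (l ^ 2 + l - 1 - x₁ - x₂) - 1) h :=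
  add_some_eq h₁ h₂ (fun h ↦ hx h.1) <| by
    rw [slope_of_X_ne hx, ← hl, mul_div_cancel_right₀ _ (sub_ne_zero.2 hx)]

theorem add_self {x y l : ℚ} (h : E15A1.toAffine.Nonsingular x y) (hv : 2 * y + x + 1 ≠ 0)
    (hl : l * (2 * y + x + 1) = 3 * x ^ 2 + 2 * x - 10 - y) :
    ∃ h', Point.some x y h + .some x y h =
      .some (l ^ 2 + l - 1 - x - x)
        (-(l * (l ^ 2 + l - 1 - x - x - x) + y) - (l ^ 2 + l - 1 - x - x) - 1) h' := by
  have hy : y ≠ -y - x - 1 := fun h ↦ hv (by linarith)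
  refine add_some_eq h h (fun h ↦ hy h.2) ?_
  rw [slope_of_Y_ne rfl (by rwa [negY_eq]), negY_eq, div_eq_iff (sub_ne_zero.2 hy)]
  simp only [E15A1]
  linear_combination -hl

theorem add_self_eq_zero {x y : ℚ} (h : E15A1.toAffine.Nonsingular x y) (hv : 2 * y + x + 1 = 0) :
    Point.some x y h + .some x y h = 0 :=
  Point.add_self_of_Y_eq (by rw [negY_eq]; linarith)

/-- A point `(x, y)` such that `x + 1`, `x - 3` and `4 * x + 13` are squares is divisible by `2`. -/
theorem exists_add_self_eq {x y a b c : ℚ} (h : E15A1.toAffine.Nonsingular x y)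
    (ha : x + 1 = a ^ 2) (hb : x - 3 = b ^ 2) (hc : 4 * x + 13 = c ^ 2) :
    ∃ Q : E15A1.toAffine.Point, Q + Q = .some x y h := by
  have heq := nonsingular_iff.1 h
  wlog hv : 2 * y + x + 1 = a * b * c generalizing c
  · refine this (c := -c) (by rw [hc]; ring) ?_
    have : (2 * y + x + 1) ^ 2 = (a * b * c) ^ 2 := by rw [heq, ha, hb, hc]; ring
    rcases sq_eq_sq_iff_eq_or_eq_neg.1 this with h' | h'
    · exact absurd h' hv
    · rw [h']; ring
  have hx : x = a ^ 2 - 1 := by linarith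
  subst hx
  have hy : y = (a * b * c - a ^ 2) / 2 := by linarith
  subst hy
  have hab : (a + b) * (a - b) = 4 := by linear_combination hb
  have hac : (2 * a + c) * (2 * a - c) = -9 := by linear_combination hc
  have hbc : (2 * b + c) * (2 * b - c) = -25 := by linear_combination -4 * hb + hc
  have hab' : a + b ≠ 0 := by rintro h0; simp [h0] at hab
  have hac' : 2 * a + c ≠ 0 := by rintro h0; simp [h0] at hac
  have hbc' : 2 * b + c ≠ 0 := by rintro h0; simp [h0] at hbc
  set X := a ^ 2 - 1 + a * b + (a * c + b * c) / 2 with hX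
  set V := (a + b) * (2 * a + c) * (2 * b + c) / 2 with hV
  have hV0 : V ≠ 0 := by positivity
  have hVeq : 2 * ((V - X - 1) / 2) + X + 1 = V := by ring
  have e1 : X + 1 = (a + b) * (2 * a + c) / 2 := by rw [hX]; ring
  have e2 : X - 3 = (a + b) * (2 * b + c) / 2 := by rw [hX]; linear_combination hb
  have e3 : 4 * X + 13 = (2 * a + c) * (2 * b + c) := by rw [hX]; linear_combination hc
  have hQ : E15A1.toAffine.Nonsingular X ((V - X - 1) / 2) := by
    rw [nonsingular_iff, hVeq, e1, e2, e3, hV]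
    ring
  have hder : 3 * X ^ 2 + 2 * X - 10 + (X + 1) / 2 = (2 * a + 2 * b + c) * V / 2 := by
    have : 3 * X ^ 2 + 2 * X - 10 + (X + 1) / 2 =
        ((X - 3) * (4 * X + 13) + (X + 1) * (4 * X + 13) + 4 * ((X + 1) * (X - 3))) / 4 := by ring
    rw [this, e1, e2, e3, hV]
    ring
  obtain ⟨h', hadd⟩ := add_self (l := (2 * a + 2 * b + c - 1) / 2) hQ (by rwa [hVeq]) (by
    rw [hVeq]
    linear_combination -hder)
  refine ⟨_, hadd.trans ?_⟩
  have hX2 : ((2 * a + 2 * b + c - 1) / 2) ^ 2 + (2 * a + 2 * b + c - 1) / 2 - 1 - X - X =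
      a ^ 2 - 1 := by
    rw [hX]
    linear_combination -hb - hc / 4
  rw [Point.some.injEq]
  refine ⟨hX2, ?_⟩
  rw [hX2, hX, hV]
  ring

/-- Translation by the two-torsion point `(-1, 0)`. -/
theorem exists_add_two_torsion_eq {x y : ℚ} (h : E15A1.toAffine.Nonsingular x y) (hx : x + 1 ≠ 0)
    (hT : E15A1.toAffine.Nonsingular (-1) 0) :
    ∃ x' y' h', Point.some x y h + .some (-1) 0 hT = .some x' y' h' ∧
      (x' + 1) * (x + 1) = -9 ∧ (x' - 3) * (x + 1) = -(4 * x + 13) ∧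
      (4 * x' + 13) * (x + 1) = 9 * (x - 3) := by
  have heq := nonsingular_iff.1 h
  obtain ⟨l, hl⟩ : ∃ l, l * (x + 1) = y := ⟨y / (x + 1), div_mul_cancel₀ _ hx⟩
  obtain ⟨h', hadd⟩ := add_of_X_ne (l := l) h hT (fun h0 ↦ hx (by linarith)) (by linarith)
  have key : (l ^ 2 + l - 1 - x - -1 + 1) * (x + 1) = -9 := by
    refine mul_right_cancel₀ hx ?_
    subst hl
    linear_combination heq / 4
  exact ⟨_, _, h', hadd, key, by linear_combination key, by linear_combination 4 * key⟩

/-- Translation by the four-torsion point `(8, 18)`. -/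
theorem exists_add_four_torsion_eq {x y : ℚ} (h : E15A1.toAffine.Nonsingular x y) (hx : x ≠ 8)
    (hT : E15A1.toAffine.Nonsingular 8 18) :
    ∃ x' y' h' L₁ L₂ L₃, Point.some x y h + .some 8 18 hT = .some x' y' h' ∧
      36 * (x + 1) * (x' + 1) = L₁ ^ 2 ∧ 20 * (x - 3) * (x' - 3) = L₂ ^ 2 ∧
      45 * (4 * x + 13) * (4 * x' + 13) = L₃ ^ 2 := by
  have heq := nonsingular_iff.1 h
  have hx8 : x - 8 ≠ 0 := sub_ne_zero.2 hx
  obtain ⟨l, hl⟩ : ∃ l, l * (x - 8) = y - 18 := ⟨(y - 18) / (x - 8), div_mul_cancel₀ _ hx8⟩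
  obtain ⟨h', hadd⟩ := add_of_X_ne (l := l) h hT hx hl
  obtain rfl : y = l * (x - 8) + 18 := by linarith
  have hl2 : (2 * l + 1) ^ 2 * (x - 8) + 90 * (2 * l + 1) = 4 * x ^ 2 + 37 * x + 258 := by
    refine mul_right_cancel₀ hx8 ?_
    linear_combination heq
  refine ⟨_, _, h', 45 - 9 * (2 * l + 1), 45 - 5 * (2 * l + 1), 45 * (2 * l + 1) - 180,
    hadd, ?_, ?_, ?_⟩
  · linear_combination 9 * hl2
  · linear_combination 5 * hl2
  · linear_combination 180 * hl2

theorem two_nsmul_eq_zero_of_x_eq {x y : ℚ} (h : E15A1.toAffine.Nonsingular x y)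
    (hx : (x + 1) * (x - 3) * (4 * x + 13) = 0) : 2 • Point.some x y h = 0 := by
  rw [two_nsmul]
  refine add_self_eq_zero h ?_
  have := nonsingular_iff.1 h
  rw [hx] at this
  exact pow_eq_zero_iff two_ne_zero |>.1 this

theorem four_nsmul_eq_zero_of_x_eq_eight {y : ℚ} (h : E15A1.toAffine.Nonsingular 8 y) :
    4 • Point.some 8 y h = 0 := by
  have heq := nonsingular_iff.1 h
  have hv0 : 2 * y + 8 + 1 ≠ 0 := by
    intro h0
    rw [h0] at heq
    norm_num at heq
  obtain ⟨h', hadd⟩ := add_self (l := (3 * 8 ^ 2 + 2 * 8 - 10 - y) / (2 * y + 8 + 1)) h hv0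
    (div_mul_cancel₀ _ hv0)
  rw [show 4 = 2 * 2 from rfl, mul_nsmul, two_nsmul (Point.some 8 y h), hadd]
  apply two_nsmul_eq_zero_of_x_eq
  have : (3 * 8 ^ 2 + 2 * 8 - 10 - y) / (2 * y + 8 + 1) - 4 = -9 * (y - 18) / (2 * y + 8 + 1) := by
    field_simp
    ring
  have hy : (y - 18) * (y + 27) = 0 := by linear_combination heq / 4
  rcases mul_eq_zero.1 hy with h0 | h0
  · obtain rfl : y = 18 := by linarith
    norm_num
  · obtain rfl : y = -27 := by linarith
    norm_num

/-- Complete `2`-descent: modulo `4`-torsion, every rational point is divisible by `2`. -/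
theorem exists_four_nsmul_eq (P : E15A1.toAffine.Point) :
    ∃ Q : E15A1.toAffine.Point, 4 • P = 8 • Q := by
  have of_double {P Q : E15A1.toAffine.Point} (h : Q + Q = P) : 4 • P = 8 • Q := by
    rw [← h]
    abel
  have hT : E15A1.toAffine.Nonsingular (-1) 0 := by rw [nonsingular_iff]; norm_num
  have hT' : E15A1.toAffine.Nonsingular 8 18 := by rw [nonsingular_iff]; norm_num
  have of_two {P : E15A1.toAffine.Point} (h : 2 • P = 0) : ∃ Q, 4 • P = 8 • Q :=
    ⟨0, by rw [show 4 = 2 * 2 from rfl, mul_nsmul, h]; simp⟩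
  have of_squares {x y a b c ε : ℚ} (h : E15A1.toAffine.Nonsingular x y) (hε : ε = 1 ∨ ε = -1)
      (ha : x + 1 = ε * a ^ 2) (hb : x - 3 = ε * b ^ 2) (hc : 4 * x + 13 = c ^ 2) :
      ∃ Q, 4 • Point.some x y h = 8 • Q := by
    rcases hε with rfl | rfl
    · obtain ⟨Q, hQ⟩ := exists_add_self_eq h (by rw [ha, one_mul]) (by rw [hb, one_mul]) hc
      exact ⟨Q, of_double hQ⟩
    by_cases hx : x + 1 = 0
    · exact of_two (two_nsmul_eq_zero_of_x_eq h (by rw [hx]; ring))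
    obtain ⟨x', y', h', hadd, h₁, h₂, h₃⟩ := exists_add_two_torsion_eq h hx hT
    have ha0 : a ≠ 0 := by
      rintro rfl
      exact hx (by rw [ha]; ring)
    rw [ha] at h₁ h₂ h₃
    rw [hc] at h₂
    rw [hb] at h₃
    have ha2 : a ^ 2 ≠ 0 := pow_ne_zero 2 ha0
    obtain ⟨Q, hQ⟩ := exists_add_self_eq (a := 3 / a) (b := c / a) (c := 3 * b / a) h'
      (by rw [div_pow, eq_div_iff ha2]; linear_combination -h₁)
      (by rw [div_pow, eq_div_iff ha2]; linear_combination -h₂)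
      (by rw [div_pow, eq_div_iff ha2]; linear_combination -h₃)
    refine ⟨Q, ?_⟩
    have h2T : 2 • Point.some (-1) 0 hT = 0 := two_nsmul_eq_zero_of_x_eq hT (by norm_num)
    rw [← of_double hQ, ← hadd, nsmul_add, show 4 • Point.some (-1) 0 hT = 0 by
      rw [show 4 = 2 * 2 from rfl, mul_nsmul, h2T, nsmul_zero], add_zero]
  rcases P with _ | ⟨x, y, h⟩
  · exact ⟨0, by rw [← Point.zero_def]; simp⟩
  by_cases hv : 2 * y + x + 1 = 0
  · exact of_two (by rw [two_nsmul, add_self_eq_zero h hv])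
  obtain ⟨ε, γ, a, b, c, hε, hγ, ha, hb, hc⟩ := squareClasses_of_sq_eq hv (nonsingular_iff.1 h)
  rcases hγ with rfl | rfl
  · exact of_squares h hε ha (by rw [hb, mul_one]) (by rw [hc, one_mul])
  by_cases hx : x = 8
  · subst hx
    exact ⟨0, by rw [four_nsmul_eq_zero_of_x_eq_eight]; simp⟩
  obtain ⟨x', y', h', L₁, L₂, L₃, hadd, h₁, h₂, h₃⟩ := exists_add_four_torsion_eq h hx hT'
  have hne : (x + 1) * (x - 3) * (4 * x + 13) ≠ 0 := by
    rw [← nonsingular_iff.1 h]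
    exact pow_ne_zero 2 hv
  rw [ha, hb, hc] at hne
  have hc0 : c ≠ 0 := by rintro rfl; simp at hne
  have hb0 : b ≠ 0 := by rintro rfl; simp at hne
  have ha0 : a ≠ 0 := by rintro rfl; simp at hne
  rw [ha] at h₁
  rw [hb] at h₂
  rw [hc] at h₃
  have hε2 : ε * ε = 1 := by rcases hε with rfl | rfl <;> norm_num
  obtain ⟨Q, hQ⟩ := of_squares (a := L₁ / (6 * a)) (b := L₂ / (10 * b)) (c := L₃ / (15 * c)) h' hε
    (by field_simp; linear_combination ε * h₁ - 36 * a ^ 2 * (x' + 1) * hε2)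
    (by field_simp; linear_combination ε * h₂ - 100 * b ^ 2 * (x' - 3) * hε2)
    (by field_simp; linear_combination h₃)
  refine ⟨Q, ?_⟩
  rw [← hQ, ← hadd, nsmul_add, four_nsmul_eq_zero_of_x_eq_eight hT', add_zero]

/-- The `x`-coordinate of the double of a point. -/
theorem exists_two_nsmul_eq {x y : ℚ} (h : E15A1.toAffine.Nonsingular x y)
    (hv : 2 * y + x + 1 ≠ 0) :
    ∃ x' y' h', 2 • Point.some x y h = .some x' y' h' ∧
      x' * (2 * y + x + 1) ^ 2 = x ^ 4 + 19 * x ^ 2 + 78 * x + 139 := by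
  obtain ⟨l, hl⟩ : ∃ l, l * (2 * y + x + 1) = 3 * x ^ 2 + 2 * x - 10 - y :=
    ⟨_, div_mul_cancel₀ _ hv⟩
  obtain ⟨h', hadd⟩ := add_self h hv hl
  refine ⟨_, _, h', by rw [two_nsmul, hadd], ?_⟩
  have heq := nonsingular_iff.1 h
  have : (l ^ 2 + l - 1 - x - x) * (2 * y + x + 1) ^ 2 = (l * (2 * y + x + 1)) ^ 2 +
      l * (2 * y + x + 1) * (2 * y + x + 1) - (1 + 2 * x) * (2 * y + x + 1) ^ 2 := by ring
  rw [this, hl]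
  linear_combination (-5/4 - 2 * x) * heq

/-- A rational number with a `2`-adic valuation of at most `-k`. -/
def DenDvd (k : ℕ) (x : ℚ) : Prop :=
  ∃ a b : ℤ, ¬ 2 ∣ a ∧ b ≠ 0 ∧ 2 ^ k ∣ b ∧ x * b = a

theorem DenDvd.pow_dvd_den {k : ℕ} {x : ℚ} (h : DenDvd k x) : 2 ^ k ∣ x.den := by
  obtain ⟨a, b, ha, -, hk, hx⟩ := h
  have hx' : x.num * b = a * x.den := by
    have hd : (x.den : ℚ) ≠ 0 := by exact_mod_cast x.den_nz
    have : (x.num : ℚ) * b = a * x.den := by rw [← hx, ← Rat.mul_den_eq_num]; ring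
    exact_mod_cast this
  have hco : IsCoprime ((2 : ℤ) ^ k) a :=
    ((Int.prime_two.coprime_iff_not_dvd).2 ha).pow_left
  have : (2 : ℤ) ^ k ∣ x.den :=
    hco.dvd_of_dvd_mul_left (hx' ▸ hk.mul_left _)
  exact_mod_cast this

/-- The doubling formula on `x`-coordinates, with denominators cleared. -/
theorem double_mul_eq {x x' v A B : ℚ} (hv : v ^ 2 = (x + 1) * (x - 3) * (4 * x + 13))
    (h : x' * v ^ 2 = x ^ 4 + 19 * x ^ 2 + 78 * x + 139) (hx : x * B = A) :
    x' * (B * ((A + B) * (A - 3 * B) * (4 * A + 13 * B))) =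
      A ^ 4 + 19 * A ^ 2 * B ^ 2 + 78 * A * B ^ 3 + 139 * B ^ 4 := by
  rw [hv] at h
  subst hx
  linear_combination B ^ 4 * h

theorem double_den_ne_zero {x v A B : ℚ} (hv0 : v ≠ 0)
    (hv : v ^ 2 = (x + 1) * (x - 3) * (4 * x + 13)) (hB : B ≠ 0) (hx : x * B = A) :
    B * ((A + B) * (A - 3 * B) * (4 * A + 13 * B)) ≠ 0 := by
  have : B * ((A + B) * (A - 3 * B) * (4 * A + 13 * B)) = B ^ 4 * v ^ 2 := by
    rw [hv, ← hx]; ring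
  rw [this]
  positivity

theorem denDvd_double {x x' v : ℚ} (hv0 : v ≠ 0) (hv : v ^ 2 = (x + 1) * (x - 3) * (4 * x + 13))
    (h : x' * v ^ 2 = x ^ 4 + 19 * x ^ 2 + 78 * x + 139) :
    DenDvd 0 x' ∧ ∀ k, DenDvd k x → DenDvd (k + 1) x' := by
  have of_frac {k : ℕ} {A B : ℤ} (hB : B ≠ 0) (hx : x * B = A) (hAB : ¬ (2 ∣ A ∧ 2 ∣ B))
      (hk : 2 ^ k ∣ B * ((A + B) * (A - 3 * B) * (4 * A + 13 * B))) : DenDvd k x' := by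
    refine ⟨A ^ 4 + 19 * A ^ 2 * B ^ 2 + 78 * A * B ^ 3 + 139 * B ^ 4, _, ?_, ?_, hk, ?_⟩
    · have two_dvd_iff (n : ℤ) : 2 ∣ n ↔ (n : ZMod 2) = 0 :=
        (ZMod.intCast_zmod_eq_zero_iff_dvd n 2).symm
      rw [two_dvd_iff, two_dvd_iff] at hAB
      rw [two_dvd_iff]
      push_cast
      revert hAB
      generalize (A : ZMod 2) = a
      generalize (B : ZMod 2) = b
      revert a b
      decide
    · have := double_den_ne_zero hv0 hv (by exact_mod_cast hB) hx
      exact_mod_cast this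
    · push_cast
      exact double_mul_eq hv h hx
  refine ⟨?_, fun k ⟨A, B, hA, hB, hk, hx⟩ ↦ of_frac hB hx (fun h ↦ hA h.1) ?_⟩
  · refine of_frac (A := x.num) (B := x.den) (by exact_mod_cast x.den_nz)
      (by exact_mod_cast x.mul_den_eq_num) (fun h ↦ ?_) (by simp)
    have := Nat.dvd_gcd (Int.natCast_dvd.1 h.1) (Int.natCast_dvd_natCast.1 h.2)
    rw [x.reduced] at this
    norm_num at this
  · rw [pow_succ]
    refine mul_dvd_mul hk ?_
    rcases Int.even_or_odd B with hB | hB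
    · exact (dvd_add (Dvd.intro (2 * A) (by ring)) (hB.two_dvd.mul_left 13)).mul_left _
    · have hA' : Odd A := Int.not_even_iff_odd.1 fun h ↦ hA h.two_dvd
      exact ((hA'.add_odd hB).two_dvd.mul_right _).mul_right _

theorem eq_zero_or_denDvd (k : ℕ) (P : E15A1.toAffine.Point) :
    2 ^ (k + 1) • P = 0 ∨ ∃ x y h, 2 ^ (k + 1) • P = .some x y h ∧ DenDvd k x := by
  have double {x y : ℚ} (h : E15A1.toAffine.Nonsingular x y) (h0 : 2 • Point.some x y h ≠ 0) :
      ∃ x' y' h', 2 • Point.some x y h = .some x' y' h' ∧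
        DenDvd 0 x' ∧ ∀ k, DenDvd k x → DenDvd (k + 1) x' := by
    have hv : 2 * y + x + 1 ≠ 0 := fun hv ↦ h0 (by rw [two_nsmul, add_self_eq_zero h hv])
    obtain ⟨x', y', h', hadd, hx'⟩ := exists_two_nsmul_eq h hv
    exact ⟨x', y', h', hadd, denDvd_double hv (nonsingular_iff.1 h) hx'⟩
  induction k with
  | zero =>
    rw [zero_add, pow_one]
    refine or_iff_not_imp_left.2 fun h0 ↦ ?_
    rcases P with _ | ⟨x, y, h⟩
    · exact absurd (nsmul_zero 2) h0
    · obtain ⟨x', y', h', hadd, hd, -⟩ := double h h0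
      exact ⟨x', y', h', hadd, hd⟩
  | succ k ih =>
    rw [pow_succ, mul_nsmul]
    rcases ih with h0 | ⟨x, y, h, hP, hk⟩
    · exact .inl (by rw [h0, nsmul_zero])
    refine or_iff_not_imp_left.2 fun h0 ↦ ?_
    rw [hP] at h0 ⊢
    obtain ⟨x', y', h', hadd, -, hd⟩ := double h h0
    exact ⟨x', y', h', hadd, hd k hk⟩

theorem four_nsmul_eq_zero (P : E15A1.toAffine.Point) : 4 • P = 0 := by
  have divisible (k : ℕ) : ∃ Q : E15A1.toAffine.Point, 4 • P = 2 ^ (k + 2) • Q := by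
    induction k with
    | zero => exact ⟨P, rfl⟩
    | succ k ih =>
      obtain ⟨Q, hQ⟩ := ih
      obtain ⟨R, hR⟩ := exists_four_nsmul_eq Q
      refine ⟨R, ?_⟩
      rw [hQ, show 2 ^ (k + 2) = 4 * 2 ^ k by ring, mul_nsmul, hR, ← mul_nsmul]
      congr 1
      ring
  by_contra h4
  rcases h : 4 • P with _ | ⟨x, y, hxy⟩
  · exact h4 h
  have hdvd (k : ℕ) : 2 ^ k ∣ x.den := by
    obtain ⟨Q, hQ⟩ := divisible k
    rcases eq_zero_or_denDvd (k + 1) Q with h0 | ⟨x', y', h', hP, hk⟩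
    · exact absurd (hQ.trans h0) h4
    · rw [← hQ, h, Point.some.injEq] at hP
      rw [hP.1]
      exact (pow_dvd_pow 2 k.le_succ).trans hk.pow_dvd_den
  exact absurd (Nat.le_of_dvd x.den_pos (hdvd x.den)) (not_le.2 Nat.lt_two_pow_self)

theorem equation_iff_mem {x y : ℚ} : E15A1.toAffine.Equation x y ↔
    (x, y) ∈ ({(-1, 0), (-2, -2), (8, -27), (3, -2), (-13/4, 9/8), (-2, 3),
      (8, 18)} : Set (ℚ × ℚ)) := by
  simp only [Set.mem_insert_iff, Set.mem_singleton_iff, Prod.mk.injEq]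
  refine ⟨fun heq ↦ ?_, ?_⟩
  · have h : E15A1.toAffine.Nonsingular x y := nonsingular_iff.2 (equation_iff.1 heq)
    rw [equation_iff] at heq
    by_cases hv : 2 * y + x + 1 = 0
    · have hy : y = -(x + 1) / 2 := by linarith
      rw [hv] at heq
      have : x = -1 ∨ x = 3 ∨ x = -13 / 4 := by
        have : (x + 1) * (x - 3) * (4 * x + 13) = 0 := by linarith
        rcases mul_eq_zero.1 this with this | this
        · rcases mul_eq_zero.1 this with this | this
          · exact .inl (by linarith)
          · exact .inr (.inl (by linarith))
        · exact .inr (.inr (by linarith))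
      subst hy
      rcases this with rfl | rfl | rfl <;> norm_num
    obtain ⟨x', y', h', hadd, hx'⟩ := exists_two_nsmul_eq h hv
    have hv' : 2 * y' + x' + 1 = 0 := by
      by_contra hv'
      obtain ⟨_, _, _, hadd', -⟩ := exists_two_nsmul_eq h' hv'
      rw [← hadd, ← mul_nsmul, four_nsmul_eq_zero] at hadd'
      exact Point.some_ne_zero _ hadd'.symm
    have heq' := nonsingular_iff.1 h'
    rw [hv', zero_pow two_ne_zero, zero_eq_mul, mul_eq_zero] at heq'
    have hvpos : 0 < (2 * y + x + 1) ^ 2 := by positivity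
    rcases heq' with (hx₁ | hx₁) | hx₁
    · have : ((x + 1) ^ 2 + 9) ^ 2 = 0 := by
        linear_combination (2 * y + x + 1) ^ 2 * hx₁ - hx' - heq
      exact absurd this (by positivity)
    · have : ((x - 8) * (x + 2)) ^ 2 = 0 := by
        linear_combination (2 * y + x + 1) ^ 2 * hx₁ - hx' + 3 * heq
      rcases mul_eq_zero.1 (pow_eq_zero_iff two_ne_zero |>.1 this) with hx | hx
      · obtain rfl : x = 8 := by linarith
        have : (y - 18) * (y + 27) = 0 := by linear_combination heq / 4
        rcases mul_eq_zero.1 this with hy | hy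
        · obtain rfl : y = 18 := by linarith
          norm_num
        · obtain rfl : y = -27 := by linarith
          norm_num
      · obtain rfl : x = -2 := by linarith
        have : (y - 3) * (y + 2) = 0 := by linear_combination heq / 4
        rcases mul_eq_zero.1 this with hy | hy
        · obtain rfl : y = 3 := by linarith
          norm_num
        · obtain rfl : y = -2 := by linarith
          norm_num
    · have : ((2 * x - 1) * (x + 7)) ^ 2 = 0 := by
        linear_combination (2 * y + x + 1) ^ 2 * hx₁ - 4 * hx' - 13 * heq
      rcases mul_eq_zero.1 (pow_eq_zero_iff two_ne_zero |>.1 this) with hx | hx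
      · obtain rfl : x = 1 / 2 := by linarith
        norm_num at heq
        linarith
      · obtain rfl : x = -7 := by linarith
        norm_num at heq
        linarith
  · rintro (⟨rfl, rfl⟩ | ⟨rfl, rfl⟩ | ⟨rfl, rfl⟩ | ⟨rfl, rfl⟩ | ⟨rfl, rfl⟩ | ⟨rfl, rfl⟩ |
      ⟨rfl, rfl⟩) <;> rw [equation_iff] <;> norm_num

theorem nonempty_addEquiv : Nonempty (E15A1.toAffine.Point ≃+ ZMod 4 × ZMod 2) := by
  have ns {x y : ℚ} (h : (2 * y + x + 1) ^ 2 = (x + 1) * (x - 3) * (4 * x + 13)) :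
      E15A1.toAffine.Nonsingular x y := nonsingular_iff.2 h
  have hA : E15A1.toAffine.Nonsingular 8 18 := ns (by norm_num)
  have hB : E15A1.toAffine.Nonsingular (-1) 0 := ns (by norm_num)
  have hA2 : E15A1.toAffine.Nonsingular 3 (-2) := ns (by norm_num)
  have hA3 : E15A1.toAffine.Nonsingular 8 (-27) := ns (by norm_num)
  have hAB : E15A1.toAffine.Nonsingular (-2) 3 := ns (by norm_num)
  have hA2B : E15A1.toAffine.Nonsingular (-13 / 4) (9 / 8) := ns (by norm_num)
  have hA3B : E15A1.toAffine.Nonsingular (-2) (-2) := ns (by norm_num)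
  have A2_eq : 2 • Point.some 8 18 hA = .some 3 (-2) hA2 := by
    obtain ⟨_, h⟩ := add_self (l := 4) hA (by norm_num) (by norm_num)
    rw [two_nsmul, h, Point.some.injEq]
    norm_num
  have A3_eq : 3 • Point.some 8 18 hA = .some 8 (-27) hA3 := by
    obtain ⟨_, h⟩ := add_of_X_ne (l := 4) hA2 hA (by norm_num) (by norm_num)
    rw [succ_nsmul, A2_eq, h, Point.some.injEq]
    norm_num
  have AB_eq : Point.some 8 18 hA + .some (-1) 0 hB = .some (-2) 3 hAB := by
    obtain ⟨_, h⟩ := add_of_X_ne (l := 2) hA hB (by norm_num) (by norm_num)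
    rw [h, Point.some.injEq]
    norm_num
  have A2B_eq : Point.some 3 (-2) hA2 + .some (-1) 0 hB = .some (-13 / 4) (9 / 8) hA2B := by
    obtain ⟨_, h⟩ := add_of_X_ne (l := -1 / 2) hA2 hB (by norm_num) (by norm_num)
    rw [h, Point.some.injEq]
    norm_num
  have A3B_eq : Point.some 8 (-27) hA3 + .some (-1) 0 hB = .some (-2) (-2) hA3B := by
    obtain ⟨_, h⟩ := add_of_X_ne (l := -3) hA3 hB (by norm_num) (by norm_num)
    rw [h, Point.some.injEq]
    norm_num
  let φ : { φ : ℤ →+ E15A1.toAffine.Point // φ (4 : ℕ) = 0 } :=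
    ⟨zmultiplesHom _ (.some 8 18 hA), by
      rw [zmultiplesHom_apply, natCast_zsmul, four_nsmul_eq_zero]⟩
  let ψ : { ψ : ℤ →+ E15A1.toAffine.Point // ψ (2 : ℕ) = 0 } :=
    ⟨zmultiplesHom _ (.some (-1) 0 hB), by
      rw [zmultiplesHom_apply, natCast_zsmul, two_nsmul_eq_zero_of_x_eq hB (by norm_num)]⟩
  let f : ZMod 4 × ZMod 2 →+ E15A1.toAffine.Point := (ZMod.lift 4 φ).coprod (ZMod.lift 2 ψ)
  have f_apply (m n : ℕ) : f (m, n) = m • .some 8 18 hA + n • .some (-1) 0 hB := by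
    have hm := ZMod.lift_coe 4 φ m
    have hn := ZMod.lift_coe 2 ψ n
    simp only [φ, ψ, Int.cast_natCast, zmultiplesHom_apply, natCast_zsmul] at hm hn
    simp only [f, φ, ψ, AddMonoidHom.coprod_apply, hm, hn]
  have f01 : f (0, 1) = .some (-1) 0 hB := by simpa using f_apply 0 1
  have f10 : f (1, 0) = .some 8 18 hA := by simpa using f_apply 1 0
  have f11 : f (1, 1) = .some (-2) 3 hAB := by simpa [AB_eq] using f_apply 1 1
  have f20 : f (2, 0) = .some 3 (-2) hA2 := by simpa [A2_eq] using f_apply 2 0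
  have f21 : f (2, 1) = .some (-13 / 4) (9 / 8) hA2B := by
    simpa [A2_eq, A2B_eq] using f_apply 2 1
  have f30 : f (3, 0) = .some 8 (-27) hA3 := by simpa [A3_eq] using f_apply 3 0
  have f31 : f (3, 1) = .some (-2) (-2) hA3B := by simpa [A3_eq, A3B_eq] using f_apply 3 1
  refine ⟨(AddEquiv.ofBijective f ⟨(injective_iff_map_eq_zero f).2 fun p hp ↦ ?_, fun P ↦ ?_⟩).symm⟩
  · have exhaust : ∀ p : ZMod 4 × ZMod 2, p = 0 ∨ p = (0, 1) ∨ p = (1, 0) ∨ p = (1, 1) ∨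
        p = (2, 0) ∨ p = (2, 1) ∨ p = (3, 0) ∨ p = (3, 1) := by decide
    rcases exhaust p with rfl | rfl | rfl | rfl | rfl | rfl | rfl | rfl
    · rfl
    all_goals
      simp only [f01, f10, f11, f20, f21, f30, f31] at hp
      exact absurd hp (Point.some_ne_zero _)
  · rcases P with _ | ⟨x, y, h⟩
    · exact ⟨0, map_zero f⟩
    have hmem := equation_iff_mem.1 h.1
    simp only [Set.mem_insert_iff, Set.mem_singleton_iff, Prod.mk.injEq] at hmem
    rcases hmem with ⟨rfl, rfl⟩ | ⟨rfl, rfl⟩ | ⟨rfl, rfl⟩ | ⟨rfl, rfl⟩ | ⟨rfl, rfl⟩ | ⟨rfl, rfl⟩ |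
      ⟨rfl, rfl⟩
    exacts [⟨_, f01⟩, ⟨_, f31⟩, ⟨_, f30⟩, ⟨_, f20⟩, ⟨_, f21⟩, ⟨_, f11⟩, ⟨_, f10⟩]

end E15A1

/-- The elliptic curve `y² + xy + y = x³ + x² − 10x − 10` over `ℚ` (15A1) has Mordell–Weil group
isomorphic to `ℤ/4ℤ × ℤ/2ℤ`; its rational points are exactly the point at infinity together with
the seven affine points `(-1,0)`, `(-2,-2)`, `(8,-27)`, `(3,-2)`, `(-13/4, 9/8)`, `(-2,3)`,
`(8,18)`. -/
theorem E15A1_mordell_weil :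
    (∀ x y : ℚ, E15A1.toAffine.Equation x y ↔
      (x, y) ∈ ({(-1, 0), (-2, -2), (8, -27), (3, -2), (-13/4, 9/8), (-2, 3),
        (8, 18)} : Set (ℚ × ℚ))) ∧
    Nonempty (E15A1.toAffine.Point ≃+ ZMod 4 × ZMod 2) := by
  exact ⟨fun _ _ ↦ E15A1.equation_iff_mem, E15A1.nonempty_addEquiv⟩
end
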